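/- Suppose ℓ satisfies the Metric Loss Assumption, f : X → Y is a measurable surjective classifier, and the optimal coupling γ*_f ∈ Γ(f#p_x, f#q_x) attaining W_{1,ℓ}(f#p_x, f#q_x) exists. Let U(f) := R_p(f) + W_{1,ℓ}(f#p_x, f#q_x) + E_y(f). Then W_{1,ℓ}(p_y, q_y) ≤ U(f). -/

import Mathlib

open MeasureTheory ProbabilityTheory

/-- A coupling of `μ` and `ν`: a joint measure on the product with the given marginals. -/
def IsCoupling {A B : Type*} [MeasurableSpace A] [MeasurableSpace B]
    (γ : Measure (A × B)) (μ : Measure A) (ν : Measure B) : Prop :=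
  γ.map Prod.fst = μ ∧ γ.map Prod.snd = ν

/-- The `α`-Wasserstein distance between `μ` and `ν` with cost function `c`:
`W_{α,c}(μ,ν) = (inf_{γ ∈ Γ(μ,ν)} ∫ c^α dγ)^{1/α}`. -/
noncomputable def Wass {A B : Type*} [MeasurableSpace A] [MeasurableSpace B]
    (α : ℝ) (c : A × B → ℝ) (μ : Measure A) (ν : Measure B) : ℝ :=
  sInf { r | ∃ γ : Measure (A × B), IsCoupling γ μ ν ∧ r = ∫ z, c z ^ α ∂γ } ^ (1 / α)

/-- The 1-Wasserstein distance between `μ` and `ν` with cost function `c`. -/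
noncomputable def W1 {A B : Type*} [MeasurableSpace A] [MeasurableSpace B]
    (c : A × B → ℝ) (μ : Measure A) (ν : Measure B) : ℝ :=
  sInf { r | ∃ γ : Measure (A × B), IsCoupling γ μ ν ∧ r = ∫ z, c z ∂γ }

/-- The risk of classifier `f` under joint distribution `p`, w.r.t. loss `ℓ`. -/
noncomputable def risk {X Y : Type*} [MeasurableSpace X] [MeasurableSpace Y]
    (ℓ : Y × Y → ℝ) (f : X → Y) (p : Measure (X × Y)) : ℝ :=
  ∫ z, ℓ (f z.1, z.2) ∂p

/-- `f#p` : pushforward of a joint measure `p` under `(x, y) ↦ (f x, y)`. -/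
noncomputable def jmap {X Y : Type*} [MeasurableSpace X] [MeasurableSpace Y]
    (f : X → Y) (p : Measure (X × Y)) : Measure (Y × Y) :=
  p.map (fun z => (f z.1, z.2))

instance jmap.instIsFiniteMeasure {X Y : Type*} [MeasurableSpace X] [MeasurableSpace Y]
    (f : X → Y) (p : Measure (X × Y)) [IsFiniteMeasure p] : IsFiniteMeasure (jmap f p) := by
  unfold jmap; infer_instance

open Set Filter Topology

/-! ### Measurable selection -/

/-- An open neighbourhood of the compact box `{α | α ≤ k}` in Baire space contains the set of
sequences bounded by `k` on some initial segment. -/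
lemma exists_bounded_initial_segment_subset (k : ℕ → ℕ) {V : Set (ℕ → ℕ)} (hV : IsOpen V)
    (hk : Iic k ⊆ V) : ∃ n, {α : ℕ → ℕ | ∀ i < n, α i ≤ k i} ⊆ V := by
  by_contra! h
  choose α hα hαV using fun n => not_subset.1 (h n)
  have hcomp : IsCompact (Iic k) := by
    rw [← pi_univ_Iic]
    exact isCompact_univ_pi fun i => (finite_Iic (k i)).isCompact
  obtain ⟨b, hb, φ, hφ, hlim⟩ := hcomp.tendsto_subseq (x := fun n => α n ⊓ k)
    fun n => mem_Iic.2 inf_le_right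
  have hαlim : Tendsto (fun n => α (φ n)) atTop (𝓝 b) := by
    rw [tendsto_pi_nhds] at hlim ⊢
    intro i
    refine (hlim i).congr' ?_
    filter_upwards [eventually_gt_atTop i] with n hn
    exact inf_eq_left.2 (hα (φ n) i (hn.trans_le (hφ.id_le n)))
  obtain ⟨n, hn⟩ := (hαlim.eventually (hV.mem_nhds (hk hb))).exists
  exact hαV _ hn

/-- Choquet capacitability for continuous images of Baire space: the outer measure of the range is
approximated by images of compact sets. -/
lemma exists_isCompact_le_measure_image {Z : Type*} [TopologicalSpace Z] [MeasurableSpace Z]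
    (μ : Measure Z) [μ.OuterRegular] {g : (ℕ → ℕ) → Z} (hg : Continuous g) {c : ENNReal}
    (hc : c < μ (range g)) : ∃ K : Set (ℕ → ℕ), IsCompact K ∧ c ≤ μ (g '' K) := by
  have step : ∀ (n : ℕ) (S : Set (ℕ → ℕ)), c < μ (g '' S) →
      ∃ k, c < μ (g '' (S ∩ {α | α n ≤ k})) := by
    intro n S hS
    have hmono : Monotone fun k => g '' (S ∩ {α | α n ≤ k}) := fun a b hab =>
      image_mono (inter_subset_inter_right _ fun α (hα : α n ≤ a) => le_trans hα hab)
    have hU : g '' S = ⋃ k, g '' (S ∩ {α | α n ≤ k}) := by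
      rw [← image_iUnion, ← inter_iUnion]
      congr 1
      exact (inter_eq_left.2 fun α _ => mem_iUnion.2 ⟨α n, le_refl (α n)⟩).symm
    rw [hU, hmono.measure_iUnion] at hS
    exact lt_iSup_iff.1 hS
  choose k hk using step
  let T : ℕ → {S : Set (ℕ → ℕ) // c < μ (g '' S)} := fun n =>
    Nat.rec ⟨univ, by rwa [image_univ]⟩ (fun n S => ⟨_, hk n S.1 S.2⟩) n
  let b : ℕ → ℕ := fun n => k n (T n).1 (T n).2
  have hT : ∀ n, (T n).1 = {α : ℕ → ℕ | ∀ i < n, α i ≤ b i} := by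
    intro n
    induction n with
    | zero => ext; simp [T]
    | succ n ih =>
      have h : (T (n + 1)).1 = (T n).1 ∩ {α | α n ≤ b n} := rfl
      rw [h, ih]
      ext α
      exact Nat.forall_lt_succ_right.symm
  refine ⟨Iic b, ?_, ?_⟩
  · rw [← pi_univ_Iic]
    exact isCompact_univ_pi fun i => (finite_Iic (b i)).isCompact
  · rw [Set.measure_eq_iInf_isOpen]
    refine le_iInf₂ fun U hU => le_iInf fun hUo => ?_
    obtain ⟨n, hn⟩ := exists_bounded_initial_segment_subset b (hUo.preimage hg)
      (image_subset_iff.1 hU)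
    rw [← hT] at hn
    exact (T n).2.le.trans (measure_mono (image_subset_iff.2 hn))

/-- The projection of a compact subset of `Z × ℝ` admits a measurable selection. -/
lemma IsCompact.exists_measurable_selection {Z : Type*} [TopologicalSpace Z] [T2Space Z]
    [MeasurableSpace Z] [OpensMeasurableSpace Z] {K : Set (Z × ℝ)} (hK : IsCompact K) :
    ∃ s : Z → ℝ, Measurable s ∧ ∀ z ∈ Prod.fst '' K, (z, s z) ∈ K := by
  have hsec : ∀ z, IsCompact {t | (z, t) ∈ K} := fun z => by
    have : {t | (z, t) ∈ K} = Prod.snd '' (K ∩ Prod.fst ⁻¹' {z}) := by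
      ext t
      constructor
      · exact fun h => ⟨(z, t), ⟨h, rfl⟩, rfl⟩
      · rintro ⟨⟨z', t'⟩, ⟨h, rfl⟩, rfl⟩
        exact h
    rw [this]
    exact (hK.inter_right (isClosed_singleton.preimage continuous_fst)).image continuous_snd
  have hmem : ∀ z ∈ Prod.fst '' K, (z, sInf {t | (z, t) ∈ K}) ∈ K := by
    rintro _ ⟨⟨z, t⟩, h, rfl⟩
    exact (hsec z).sInf_mem ⟨t, h⟩
  refine ⟨fun z => sInf {t | (z, t) ∈ K}, measurable_of_Iic fun t => ?_, hmem⟩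
  have hpre : (fun z => sInf {t | (z, t) ∈ K}) ⁻¹' Iic t =
      Prod.fst '' (K ∩ Prod.snd ⁻¹' Iic t) ∪ ((Prod.fst '' K)ᶜ ∩ {_z | 0 ≤ t}) := by
    ext z
    by_cases hz : z ∈ Prod.fst '' K
    · simp only [mem_preimage, mem_Iic, mem_union, mem_inter_iff, mem_compl_iff, hz,
        not_true_eq_false, false_and, or_false]
      constructor
      · exact fun h => ⟨_, ⟨hmem z hz, h⟩, rfl⟩
      · rintro ⟨⟨z', t'⟩, ⟨h, h'⟩, rfl⟩
        exact (csInf_le (hsec z').bddBelow h).trans h'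
    · have hempty : {t | (z, t) ∈ K} = ∅ :=
        eq_empty_of_forall_notMem fun t ht => hz ⟨_, ht, rfl⟩
      have hz' : z ∉ Prod.fst '' (K ∩ Prod.snd ⁻¹' Iic t) := fun h =>
        hz (image_mono inter_subset_left h)
      simp [-mem_image, hempty, hz, hz']
  rw [hpre]
  have h1 := ((hK.inter_right (isClosed_Iic.preimage continuous_snd : IsClosed
    ((Prod.snd : Z × ℝ → ℝ) ⁻¹' Iic t))).image continuous_fst).isClosed.measurableSet
  exact h1.union ((hK.image continuous_fst).isClosed.measurableSet.compl.inter (.const _))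

/-- **Measurable selection**: a Borel subset of a product of standard Borel spaces has a
measurable selection, defined almost everywhere on its projection. -/
theorem MeasurableSet.exists_measurable_selection_real {Z : Type*} [MeasurableSpace Z]
    [StandardBorelSpace Z] (μ : Measure Z) [IsFiniteMeasure μ]
    {B : Set (Z × ℝ)} (hB : MeasurableSet B) :
    ∃ s : Z → ℝ, Measurable s ∧ ∀ᵐ z ∂μ, (∃ t, (z, t) ∈ B) → (z, s z) ∈ B := by
  let := upgradeStandardBorel Z
  have hA := hB.analyticSet
  rw [AnalyticSet] at hA
  obtain rfl | ⟨φ, hφ, rfl⟩ := hA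
  · exact ⟨0, measurable_const, by simp⟩
  set g : (ℕ → ℕ) → Z := fun α => (φ α).1
  have hg : Continuous g := continuous_fst.comp hφ
  have approx : ∀ c : Iio (μ (range g)), ∃ (A : Set Z) (s : Z → ℝ), MeasurableSet A ∧
      Measurable s ∧ A ⊆ range g ∧ c.1 ≤ μ A ∧ ∀ z ∈ A, (z, s z) ∈ range φ := by
    rintro ⟨c, hc⟩
    obtain ⟨K, hK, hcK⟩ := exists_isCompact_le_measure_image μ hg hc
    obtain ⟨s, hs, hsK⟩ := (hK.image hφ).exists_measurable_selection
    rw [image_image] at hsK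
    exact ⟨g '' K, s, (hK.image hg).isClosed.measurableSet, hs, image_subset_range _ _, hcK,
      fun z hz => image_subset_range _ _ (hsK z hz)⟩
  obtain h0 | h0 := eq_or_ne (μ (range g)) 0
  · refine ⟨0, measurable_const, ?_⟩
    filter_upwards [measure_eq_zero_iff_ae_notMem.1 h0] with z hz
    rintro ⟨t, α, hα⟩
    exact absurd ⟨α, by simp [g, hα]⟩ hz
  obtain ⟨c, -, hc, hclim⟩ := exists_seq_strictMono_tendsto' (pos_iff_ne_zero.2 h0)
  choose A s hAm hsm hAg hcA hs using fun n => approx ⟨c n, (hc n).2⟩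
  obtain ⟨r, hr, hrs⟩ := exists_measurable_piecewise (disjointed A) (.disjointed hAm) s hsm
    fun i j hij x hx => absurd hx.2 ((disjoint_disjointed A hij).notMem_of_mem_left hx.1)
  have hnull : μ (range g \ ⋃ n, A n) = 0 := by
    rw [measure_sdiff (iUnion_subset hAg) (MeasurableSet.iUnion hAm).nullMeasurableSet
      (measure_ne_top _ _), tsub_eq_zero_iff_le]
    exact le_of_tendsto' hclim fun n => (hcA n).trans (measure_mono (subset_iUnion A n))
  refine ⟨r, hr, ?_⟩
  filter_upwards [measure_eq_zero_iff_ae_notMem.1 hnull] with z hz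
  rintro ⟨t, α, hα⟩
  have hzg : z ∈ range g := ⟨α, by simp [g, hα]⟩
  have hzA : z ∈ ⋃ n, disjointed A n := by
    rw [iUnion_disjointed]
    by_contra h
    exact hz ⟨hzg, h⟩
  obtain ⟨n, hn⟩ := mem_iUnion.1 hzA
  rw [hrs n hn]
  exact hs n z (disjointed_subset A n hn)

theorem MeasurableSet.exists_measurable_selection {Z W : Type*} [MeasurableSpace Z]
    [StandardBorelSpace Z] [MeasurableSpace W] [StandardBorelSpace W] [Nonempty W]
    (μ : Measure Z) [IsFiniteMeasure μ] {B : Set (Z × W)} (hB : MeasurableSet B) :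
    ∃ s : Z → W, Measurable s ∧ ∀ᵐ z ∂μ, (∃ w, (z, w) ∈ B) → (z, s z) ∈ B := by
  have he := measurableEmbedding_embeddingReal W
  obtain ⟨s, hs, hsB⟩ := ((MeasurableEmbedding.id.prodMap he).measurableSet_image.2
    hB).exists_measurable_selection_real μ
  refine ⟨he.invFun ∘ s, he.measurable_invFun.comp hs, ?_⟩
  filter_upwards [hsB] with z hz
  rintro ⟨w, hw⟩
  obtain ⟨⟨z', w'⟩, h, heq⟩ := hz ⟨_, _, hw, rfl⟩
  simp only [Prod.map_apply, id_eq, Prod.mk.injEq] at heq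
  obtain ⟨rfl, hw'⟩ := heq
  rwa [Function.comp_apply, ← hw', he.leftInverse_invFun]

/-- Projections of Borel sets are universally measurable. -/
theorem MeasurableSet.nullMeasurableSet_exists {Z W : Type*} [MeasurableSpace Z]
    [StandardBorelSpace Z] [MeasurableSpace W] [StandardBorelSpace W] [Nonempty W]
    (μ : Measure Z) [IsFiniteMeasure μ] {B : Set (Z × W)} (hB : MeasurableSet B) :
    NullMeasurableSet {z | ∃ w, (z, w) ∈ B} μ := by
  obtain ⟨s, hs, hsB⟩ := hB.exists_measurable_selection μ
  refine ((measurable_id.prodMk hs) hB).nullMeasurableSet.congr ?_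
  filter_upwards [hsB] with z hz
  exact propext ⟨fun h => ⟨s z, h⟩, hz⟩

/-! ### Parametrising probability measures -/

/-- All probability measures on a standard Borel space are values of a single Markov kernel with
a standard Borel source. -/
lemma exists_universal_markovKernel (T : Type*) [MeasurableSpace T] [StandardBorelSpace T]
    [Nonempty T] : ∃ K : Kernel (ℚ → ℝ) T, IsMarkovKernel K ∧
      ∀ m : Measure T, IsProbabilityMeasure m → ∃ w, K w = m := by
  have he := measurableEmbedding_embeddingReal T
  let K₀ : Kernel (ℚ → ℝ) ℝ := ⟨fun w => (stieltjesOfMeasurableRat id measurable_id w).measure,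
    measurable_measure_stieltjesOfMeasurableRat measurable_id⟩
  have : IsMarkovKernel K₀ := ⟨fun w => instIsProbabilityMeasure_stieltjesOfMeasurableRat _ w⟩
  refine ⟨K₀.map he.invFun, Kernel.IsMarkovKernel.map _ he.measurable_invFun, fun m hm => ?_⟩
  set ν := m.map (embeddingReal T) with hν
  have : IsProbabilityMeasure ν := Measure.isProbabilityMeasure_map he.measurable.aemeasurable
  let w : ℚ → ℝ := fun r => cdf ν r
  have hw : IsRatStieltjesPoint id w :=
    { mono := fun a b hab => monotone_cdf ν (by exact_mod_cast hab)
      tendsto_atTop_one := (tendsto_cdf_atTop ν).comp (tendsto_ratCast_atTop_iff.2 tendsto_id)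
      tendsto_atBot_zero := (tendsto_cdf_atBot ν).comp (tendsto_ratCast_atBot_iff.2 tendsto_id)
      iInf_rat_gt_eq := fun t => by
        refine Eq.trans ?_ ((cdf ν).iInf_rat_gt_eq t)
        exact (Equiv.subtypeEquivRight fun r => by simp).iInf_congr fun r => rfl }
  have hK₀ : K₀ w = ν := by
    refine ext_of_generate_finite _ (BorelSpace.measurable_eq.trans
      Real.borel_eq_generateFrom_Iic_rat) Real.isPiSystem_Iic_rat ?_ (by simp)
    rintro _ ⟨_, ⟨r, rfl⟩, rfl⟩
    change (stieltjesOfMeasurableRat id measurable_id w).measure _ = _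
    rw [measure_stieltjesOfMeasurableRat_Iic, stieltjesOfMeasurableRat_eq,
      toRatCDF_of_isRatStieltjesPoint hw, ← ofReal_cdf]
    rfl
  refine ⟨w, ?_⟩
  rw [Kernel.map_apply _ he.measurable_invFun, hK₀, hν,
    Measure.map_map he.measurable_invFun he.measurable, he.leftInverse_invFun.comp_eq_id,
    Measure.map_id]

lemma measurableSet_kernel_eq {A T : Type*} [MeasurableSpace A] [MeasurableSpace T]
    [StandardBorelSpace T] (κ η : Kernel A T) [IsMarkovKernel κ] [IsMarkovKernel η] :
    MeasurableSet {a | κ a = η a} := by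
  have he := measurableEmbedding_embeddingReal T
  have h : {a | κ a = η a} = ⋂ r : ℚ, {a | κ a (embeddingReal T ⁻¹' Iic (r : ℝ)) =
      η a (embeddingReal T ⁻¹' Iic (r : ℝ))} := by
    ext a
    rw [mem_iInter]
    refine ⟨fun h r => congrArg (fun m : Measure T => m _) h, fun h => ?_⟩
    refine ext_of_generate_finite (preimage (embeddingReal T) '' ⋃ r : ℚ, {Iic (r : ℝ)}) ?_
      (Real.isPiSystem_Iic_rat.comap _) ?_ (by simp)
    · rw [← MeasurableSpace.comap_generateFrom, ← Real.borel_eq_generateFrom_Iic_rat,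
        ← BorelSpace.measurable_eq, he.comap_eq]
    · rintro _ ⟨_, ⟨_, ⟨r, rfl⟩, rfl⟩, rfl⟩
      exact h r
  rw [h]
  exact .iInter fun r => measurableSet_eq_fun
    (κ.measurable_coe (he.measurable measurableSet_Iic))
    (η.measurable_coe (he.measurable measurableSet_Iic))

/-! ### Convexity of the transport cost -/

lemma W1_le_integral {A B : Type*} [MeasurableSpace A] [MeasurableSpace B] {c : A × B → ℝ}
    (hc : 0 ≤ c) {μ : Measure A} {ν : Measure B} {γ : Measure (A × B)} (hγ : IsCoupling γ μ ν) :
    W1 c μ ν ≤ ∫ z, c z ∂γ :=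
  csInf_le ⟨0, by rintro _ ⟨γ, -, rfl⟩; exact integral_nonneg hc⟩ ⟨γ, hγ, rfl⟩

lemma W1_nonneg {A B : Type*} [MeasurableSpace A] [MeasurableSpace B] {c : A × B → ℝ}
    (hc : 0 ≤ c) (μ : Measure A) (ν : Measure B) : 0 ≤ W1 c μ ν :=
  Real.sInf_nonneg (by rintro _ ⟨γ, -, rfl⟩; exact integral_nonneg hc)

lemma W1_lt_iff {A B : Type*} [MeasurableSpace A] [MeasurableSpace B] {c : A × B → ℝ}
    (hc : 0 ≤ c) (μ : Measure A) (ν : Measure B) [IsProbabilityMeasure μ]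
    [IsProbabilityMeasure ν] {r : ℝ} :
    W1 c μ ν < r ↔ ∃ γ, IsCoupling γ μ ν ∧ ∫ z, c z ∂γ < r := by
  unfold W1
  have hbdd : BddBelow {r | ∃ γ, IsCoupling γ μ ν ∧ r = ∫ z, c z ∂γ} :=
    ⟨0, by rintro _ ⟨γ, -, rfl⟩; exact integral_nonneg hc⟩
  have hne : {r | ∃ γ, IsCoupling γ μ ν ∧ r = ∫ z, c z ∂γ}.Nonempty :=
    ⟨_, μ.prod ν, ⟨by simp [Measure.map_fst_prod], by simp [Measure.map_snd_prod]⟩, rfl⟩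
  rw [csInf_lt_iff hbdd hne]
  constructor
  · rintro ⟨_, ⟨γ, hγ, rfl⟩, h⟩
    exact ⟨γ, hγ, h⟩
  · rintro ⟨γ, hγ, h⟩
    exact ⟨_, ⟨γ, hγ, rfl⟩, h⟩

/-- A measure whose first marginal is a probability measure is a probability measure. -/
lemma IsCoupling.isProbabilityMeasure {A B : Type*} [MeasurableSpace A] [MeasurableSpace B]
    {γ : Measure (A × B)} {μ : Measure A} {ν : Measure B} [IsProbabilityMeasure μ]
    (hγ : IsCoupling γ μ ν) : IsProbabilityMeasure γ :=
  ⟨by rw [← measure_univ (μ := μ), ← hγ.1, Measure.map_apply measurable_fst .univ, preimage_univ]⟩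

/-- The transport cost of a mixture is at most the mixture of the transport costs. -/
theorem W1_comp_le_integral_W1 {Z A B : Type*} [MeasurableSpace Z] [StandardBorelSpace Z]
    [MeasurableSpace A] [StandardBorelSpace A] [Nonempty A]
    [MeasurableSpace B] [StandardBorelSpace B] [Nonempty B] {c : A × B → ℝ}
    (hcm : Measurable c) (hc : 0 ≤ c) (μ : Measure Z) [IsProbabilityMeasure μ]
    (κ : Kernel Z A) (η : Kernel Z B) [IsMarkovKernel κ] [IsMarkovKernel η] :
    W1 c (κ ∘ₘ μ) (η ∘ₘ μ) ≤ ∫ z, W1 c (κ z) (η z) ∂μ := by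
  have hnonneg : 0 ≤ ∫ z, W1 c (κ z) (η z) ∂μ := integral_nonneg fun z => W1_nonneg hc _ _
  -- a coupling with non-integrable cost has Bochner integral zero
  by_cases hint : ∀ γ, IsCoupling γ (κ ∘ₘ μ) (η ∘ₘ μ) → Integrable c γ
  swap
  · push Not at hint
    obtain ⟨γ, hγ, hγc⟩ := hint
    exact (W1_le_integral hc hγ).trans (by rwa [integral_undef hγc])
  obtain ⟨K, hK, hKsurj⟩ := exists_universal_markovKernel (A × B)
  let C : Set (Z × (ℚ → ℝ)) := {x | IsCoupling (K x.2) (κ x.1) (η x.1)}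
  have hC : MeasurableSet C := by
    have : IsMarkovKernel (K.map Prod.fst) := Kernel.IsMarkovKernel.map _ measurable_fst
    have : IsMarkovKernel (K.map Prod.snd) := Kernel.IsMarkovKernel.map _ measurable_snd
    have h1 := measurableSet_kernel_eq ((K.map Prod.fst).comap Prod.snd measurable_snd)
      (κ.comap (Prod.fst : Z × (ℚ → ℝ) → Z) measurable_fst)
    have h2 := measurableSet_kernel_eq ((K.map Prod.snd).comap Prod.snd measurable_snd)
      (η.comap (Prod.fst : Z × (ℚ → ℝ) → Z) measurable_fst)
    refine (h1.inter h2).congr ?_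
    ext x
    simp [C, IsCoupling, Kernel.map_apply _ measurable_fst, Kernel.map_apply _ measurable_snd]
  have hcost : Measurable fun x : Z × (ℚ → ℝ) => ∫ y, c y ∂(K x.2) :=
    (hcm.stronglyMeasurable.integral_kernel (κ := K)).measurable.comp measurable_snd
  have hlt : ∀ z r, W1 c (κ z) (η z) < r ↔ ∃ w, (z, w) ∈ C ∧ ∫ y, c y ∂(K w) < r := by
    intro z r
    rw [W1_lt_iff hc]
    constructor
    · rintro ⟨γ, hγ, h⟩
      obtain ⟨w, rfl⟩ := hKsurj γ hγ.isProbabilityMeasure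
      exact ⟨w, hγ, h⟩
    · rintro ⟨w, hw, h⟩
      exact ⟨K w, hw, h⟩
  have hWm : AEMeasurable (fun z => W1 c (κ z) (η z)) μ := by
    have hnull : ∀ r, NullMeasurableSet {z | W1 c (κ z) (η z) < r} μ := fun r => by
      have : {z | W1 c (κ z) (η z) < r} =
          {z | ∃ w, (z, w) ∈ C ∩ {x | ∫ y, c y ∂(K x.2) < r}} := by
        ext z
        exact hlt z r
      rw [this]
      exact (hC.inter (measurableSet_lt hcost measurable_const)).nullMeasurableSet_exists μ
    have hnm : NullMeasurable (fun z => W1 c (κ z) (η z)) μ :=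
      measurable_of_Iio (δ := NullMeasurableSpace Z μ) hnull
    exact hnm.aemeasurable
  refine le_of_forall_pos_le_add fun ε hε => ?_
  obtain ⟨s, hs, hsB⟩ := (hC.inter (measurableSet_lt hcost
    ((hWm.measurable_mk.comp measurable_fst).add_const ε))).exists_measurable_selection μ
  have hsel : ∀ᵐ z ∂μ, IsCoupling (K (s z)) (κ z) (η z) ∧
      ∫ y, c y ∂(K (s z)) < W1 c (κ z) (η z) + ε := by
    filter_upwards [hsB, hWm.ae_eq_mk] with z hz hmk
    obtain ⟨w, hw, hwr⟩ := (hlt z (W1 c (κ z) (η z) + ε)).1 (by linarith)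
    have := hz ⟨w, hw, by simpa [← hmk] using hwr⟩
    exact ⟨this.1, by simpa [← hmk] using this.2⟩
  let ρ := K.comap s hs
  have hcoup : IsCoupling (ρ ∘ₘ μ) (κ ∘ₘ μ) (η ∘ₘ μ) := by
    constructor
    · rw [Measure.map_comp _ _ measurable_fst]
      refine Measure.bind_congr_right ?_
      filter_upwards [hsel] with z hz
      rw [Kernel.map_apply _ measurable_fst]
      exact hz.1.1
    · rw [Measure.map_comp _ _ measurable_snd]
      refine Measure.bind_congr_right ?_
      filter_upwards [hsel] with z hz
      rw [Kernel.map_apply _ measurable_snd]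
      exact hz.1.2
  have hcρ := hint _ hcoup
  have hρint : Integrable (fun z => ∫ y, c y ∂(ρ z)) μ := by
    have := ((Measure.integrable_comp_iff hcρ.1).1 hcρ).2
    simpa only [Real.norm_of_nonneg (hc _)] using this
  have hWint : Integrable (fun z => W1 c (κ z) (η z)) μ := by
    refine hρint.mono' hWm.aestronglyMeasurable ?_
    filter_upwards [hsel] with z hz
    rw [Real.norm_of_nonneg (W1_nonneg hc _ _)]
    exact W1_le_integral hc hz.1
  calc W1 c (κ ∘ₘ μ) (η ∘ₘ μ) ≤ ∫ y, c y ∂(ρ ∘ₘ μ) := W1_le_integral hc hcoup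
    _ = ∫ z, ∫ y, c y ∂(ρ z) ∂μ := by
      rw [Measure.comp_eq_comp_const_apply] at hcρ ⊢
      exact Kernel.integral_comp hcρ
    _ ≤ ∫ z, (W1 c (κ z) (η z) + ε) ∂μ := by
      refine integral_mono_ae hρint (hWint.add (integrable_const ε)) ?_
      filter_upwards [hsel] with z hz
      exact hz.2.le
    _ = ∫ z, W1 c (κ z) (η z) ∂μ + ε := by
      rw [integral_add hWint (integrable_const ε)]
      simp

/-- Averaging the conditional law of the label given the prediction recovers the label law. -/
lemma condKernel_jmap_comp {X Y : Type*} [MeasurableSpace X] [MeasurableSpace Y]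
    [StandardBorelSpace Y] [Nonempty Y] (p : Measure (X × Y)) [IsProbabilityMeasure p]
    {f : X → Y} (hf : Measurable f) :
    (jmap f p).condKernel ∘ₘ (p.map fun z => f z.1) = p.map Prod.snd := by
  have hm : Measurable fun z : X × Y => (f z.1, z.2) := by fun_prop
  have hfst : (jmap f p).fst = p.map fun z => f z.1 := by
    rw [Measure.fst, jmap, Measure.map_map measurable_fst hm]
    rfl
  rw [← hfst, ← Measure.snd_compProd, (jmap f p).disintegrate, Measure.snd, jmap,
    Measure.map_map measurable_snd hm]
  rfl

theorem statement14 {X Y : Type*} [MeasurableSpace X] [MeasurableSpace Y]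
    [StandardBorelSpace X] [StandardBorelSpace Y] [Nonempty Y]
    (ℓ : Y × Y → ℝ) (hℓmeas : Measurable ℓ)
    (hsymm : ∀ y y' : Y, ℓ (y, y') = ℓ (y', y))
    (hnonneg : ∀ y y' : Y, 0 ≤ ℓ (y, y'))
    (htri : ∀ y₁ y₂ y₃ : Y, ℓ (y₁, y₃) ≤ ℓ (y₁, y₂) + ℓ (y₂, y₃))
    (hid : ∀ y y' : Y, ℓ (y, y') = 0 ↔ y = y')
    (p q : Measure (X × Y)) [IsProbabilityMeasure p] [IsProbabilityMeasure q]
    (f : X → Y) (hf : Measurable f) (hsurj : Function.Surjective f)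
    (γf : Measure (Y × Y))
    (hγf : IsCoupling γf (p.map (fun z => f z.1)) (q.map (fun z => f z.1)))
    (hγfopt : ∫ z, ℓ z ∂γf = W1 ℓ (p.map (fun z => f z.1)) (q.map (fun z => f z.1))) :
    W1 ℓ (p.map Prod.snd) (q.map Prod.snd) ≤
      risk ℓ f p + W1 ℓ (p.map (fun z => f z.1)) (q.map (fun z => f z.1)) +
        ∫ z, W1 ℓ ((jmap f p).condKernel z.1) ((jmap f q).condKernel z.2) ∂γf := by
  have hℓ : 0 ≤ ℓ := fun z => hnonneg z.1 z.2
  have : IsProbabilityMeasure (p.map fun z => f z.1) :=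
    Measure.isProbabilityMeasure_map (by fun_prop)
  have : IsProbabilityMeasure γf := hγf.isProbabilityMeasure
  have hE := W1_comp_le_integral_W1 hℓmeas hℓ γf
    ((jmap f p).condKernel.comap Prod.fst measurable_fst)
    ((jmap f q).condKernel.comap Prod.snd measurable_snd)
  rw [← Kernel.comp_deterministic_eq_comap, ← Kernel.comp_deterministic_eq_comap,
    ← Measure.comp_assoc, ← Measure.comp_assoc, Measure.deterministic_comp_eq_map,
    Measure.deterministic_comp_eq_map, hγf.1, hγf.2, condKernel_jmap_comp p hf,
    condKernel_jmap_comp q hf] at hE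
  have hrisk : 0 ≤ risk ℓ f p := integral_nonneg fun z => hℓ _
  have hW := W1_nonneg hℓ (p.map fun z => f z.1) (q.map fun z => f z.1)
  simp only [Kernel.comp_deterministic_eq_comap, Kernel.comap_apply] at hE
  linarith
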